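/- Let h, g : ℝ³ × (0,∞) → ℝ be measurable functions such that all the integrals below converge absolutely. Then the resonant linearized collision operator is symmetric and nonnegative with respect to the weighted inner product: ∫_{ℝ³×[0,∞)} (L_r h)(ξ,I) g(ξ,I) M_r(ξ,I) dξ dI = ∫_{ℝ³×[0,∞)} h(ξ,I) (L_r g)(ξ,I) M_r(ξ,I) dξ dI, and ∫_{ℝ³×[0,∞)} (L_r h)(ξ,I) h(ξ,I) M_r(ξ,I) dξ dI ≥ 0. -/

import Mathlib

noncomputable section

open MeasureTheory Real
open scoped BigOperators RealInnerProductSpace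

abbrev V3 : Type := EuclideanSpace ℝ (Fin 3)

abbrev Sph : Type := Metric.sphere (0 : V3) 1

/-- The surface measure on the unit sphere `S²` (total mass `4π`). -/
def sphMeasure : Measure Sph := (volume : Measure V3).toSphere

/-- The measure `dξ dI` on `ℝ³ × [0,∞)`. -/
def phaseMeasure : Measure (V3 × ℝ) :=
  (volume : Measure V3).prod ((volume : Measure ℝ).restrict (Set.Ici 0))

/-- Total energy `E = (m/4)|ξ−ξ_*|² + I + I_*` in the center-of-mass frame. -/
def collE (m : ℝ) (ξ ξs : V3) (I Is : ℝ) : ℝ :=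
  m / 4 * ‖ξ - ξs‖ ^ 2 + I + Is

/-- Post-collisional velocity `ξ'` for standard (Borgnakke–Larsen) collisions. -/
def xiPrimeStd (m : ℝ) (ξ ξs : V3) (I Is R : ℝ) (σ : Sph) : V3 :=
  (1 / 2 : ℝ) • (ξ + ξs) + Real.sqrt (R * collE m ξ ξs I Is / m) • (σ : V3)

/-- Post-collisional velocity `ξ_*'` for standard collisions. -/
def xiStarPrimeStd (m : ℝ) (ξ ξs : V3) (I Is R : ℝ) (σ : Sph) : V3 :=
  (1 / 2 : ℝ) • (ξ + ξs) - Real.sqrt (R * collE m ξ ξs I Is / m) • (σ : V3)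

/-- Post-collisional internal energy `I' = r(1−R)E` for standard collisions. -/
def IPrimeStd (m : ℝ) (ξ ξs : V3) (I Is R r : ℝ) : ℝ :=
  r * (1 - R) * collE m ξ ξs I Is

/-- Post-collisional internal energy `I_*' = (1−r)(1−R)E` for standard collisions. -/
def IStarPrimeStd (m : ℝ) (ξ ξs : V3) (I Is R r : ℝ) : ℝ :=
  (1 - r) * (1 - R) * collE m ξ ξs I Is

/-- Integrand of the standard collision operator `Q_s`. -/
def stdIntegrand (m δ α β Cs : ℝ) (f F : V3 → ℝ → ℝ)
    (ξ : V3) (I : ℝ) (ξs : V3) (Is : ℝ) (σ : Sph) (r R : ℝ) : ℝ :=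
  ((f (xiPrimeStd m ξ ξs I Is R σ) (IPrimeStd m ξ ξs I Is R r) *
        F (xiStarPrimeStd m ξ ξs I Is R σ) (IStarPrimeStd m ξ ξs I Is R r) +
      f (xiStarPrimeStd m ξ ξs I Is R σ) (IStarPrimeStd m ξ ξs I Is R r) *
        F (xiPrimeStd m ξ ξs I Is R σ) (IPrimeStd m ξ ξs I Is R r)) /
      (IPrimeStd m ξ ξs I Is R r * IStarPrimeStd m ξ ξs I Is R r) ^ (δ / 2 - 1) -
    (f ξ I * F ξs Is + f ξs Is * F ξ I) / (I * Is) ^ (δ / 2 - 1)) *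
  (Cs * (I + Is) ^ α * ‖ξ - ξs‖ ^ β * (I * Is) ^ (δ / 2 - 1) *
    (r * (1 - r)) ^ (δ / 2 - 1) * (1 - R) ^ (α + δ - 1) * R ^ ((β + 1) / 2))

/-- The standard (inelastic) collision operator `Q_s(f,F)`. -/
def Qs (m δ α β Cs : ℝ) (f F : V3 → ℝ → ℝ) (ξ : V3) (I : ℝ) : ℝ :=
  (1 / 2) * ∫ Is in Set.Ici (0 : ℝ), ∫ ξs : V3,
    (∫ σ : Sph, (∫ r in Set.Icc (0 : ℝ) 1, ∫ R in Set.Icc (0 : ℝ) 1,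
      stdIntegrand m δ α β Cs f F ξ I ξs Is σ r R) ∂sphMeasure)

/-- Post-collisional velocity `ξ'` for resonant collisions. -/
def xiPrimeRes (ξ ξs : V3) (σ : Sph) : V3 :=
  (1 / 2 : ℝ) • (ξ + ξs) + (‖ξ - ξs‖ / 2) • (σ : V3)

/-- Post-collisional velocity `ξ_*'` for resonant collisions. -/
def xiStarPrimeRes (ξ ξs : V3) (σ : Sph) : V3 :=
  (1 / 2 : ℝ) • (ξ + ξs) - (‖ξ - ξs‖ / 2) • (σ : V3)

/-- Post-collisional internal energy `I' = r(I+I_*)` for resonant collisions. -/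
def IPrimeRes (I Is r : ℝ) : ℝ := r * (I + Is)

/-- Post-collisional internal energy `I_*' = (1−r)(I+I_*)` for resonant collisions. -/
def IStarPrimeRes (I Is r : ℝ) : ℝ := (1 - r) * (I + Is)

/-- Integrand of the resonant collision operator `Q_r`. -/
def resIntegrand (δ α β Cr : ℝ) (f F : V3 → ℝ → ℝ)
    (ξ : V3) (I : ℝ) (ξs : V3) (Is : ℝ) (σ : Sph) (r : ℝ) : ℝ :=
  ((f (xiPrimeRes ξ ξs σ) (IPrimeRes I Is r) * F (xiStarPrimeRes ξ ξs σ) (IStarPrimeRes I Is r) +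
      f (xiStarPrimeRes ξ ξs σ) (IStarPrimeRes I Is r) * F (xiPrimeRes ξ ξs σ) (IPrimeRes I Is r)) /
      (IPrimeRes I Is r * IStarPrimeRes I Is r) ^ (δ / 2 - 1) -
    (f ξ I * F ξs Is + f ξs Is * F ξ I) / (I * Is) ^ (δ / 2 - 1)) *
  (Cr * (I + Is) ^ α * ‖ξ - ξs‖ ^ β * (I * Is) ^ (δ / 2 - 1) * (r * (1 - r)) ^ (δ / 2 - 1))

/-- The resonant (elastic) collision operator `Q_r(f,F)`. -/
def Qr (δ α β Cr : ℝ) (f F : V3 → ℝ → ℝ) (ξ : V3) (I : ℝ) : ℝ :=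
  (1 / 2) * ∫ Is in Set.Ici (0 : ℝ), ∫ ξs : V3,
    (∫ σ : Sph, (∫ r in Set.Icc (0 : ℝ) 1,
      resIntegrand δ α β Cr f F ξ I ξs Is σ r) ∂sphMeasure)

/-- The Maxwellian equilibrium distribution `M_s`. -/
def Ms (m kB δ n T : ℝ) (u : V3) (ξ : V3) (I : ℝ) : ℝ :=
  n * I ^ (δ / 2 - 1) /
      ((2 * π * kB * T / m) ^ ((3 : ℝ) / 2) * (kB * T) ^ (δ / 2) * Real.Gamma (δ / 2)) *
    Real.exp (-(m * ‖ξ - u‖ ^ 2 + 2 * I) / (2 * kB * T))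

/-- The two-temperature equilibrium distribution `M_r`. -/
def Mr (m kB δ n Ttr Tint : ℝ) (u : V3) (ξ : V3) (I : ℝ) : ℝ :=
  n * I ^ (δ / 2 - 1) /
      ((2 * π * kB * Ttr / m) ^ ((3 : ℝ) / 2) * (kB * Tint) ^ (δ / 2) * Real.Gamma (δ / 2)) *
    Real.exp (-(m * ‖ξ - u‖ ^ 2) / (2 * kB * Ttr) - I / (kB * Tint))

/-- Integrand of the resonant linearized collision operator `L_r`. -/
def LrIntegrand (m kB δ n Ttr Tint α β : ℝ) (u : V3) (h : V3 → ℝ → ℝ)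
    (ξ : V3) (I : ℝ) (Is : ℝ) (ξs : V3) (σ : Sph) (r : ℝ) : ℝ :=
  Mr m kB δ n Ttr Tint u ξs Is *
    (h (xiStarPrimeRes ξ ξs σ) (IStarPrimeRes I Is r) + h (xiPrimeRes ξ ξs σ) (IPrimeRes I Is r) -
      h ξs Is - h ξ I) *
    (I + Is) ^ α * ‖ξ - ξs‖ ^ β * (r * (1 - r)) ^ (δ / 2 - 1)

/-- The resonant linearized collision operator `L_r`. -/
def Lr (m kB δ n Ttr Tint α β Cr : ℝ) (u : V3) (h : V3 → ℝ → ℝ) (ξ : V3) (I : ℝ) : ℝ :=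
  -Cr * ∫ Is in Set.Ici (0 : ℝ), ∫ ξs : V3,
    (∫ σ : Sph, (∫ r in Set.Icc (0 : ℝ) 1,
      LrIntegrand m kB δ n Ttr Tint α β u h ξ I Is ξs σ r) ∂sphMeasure)

/-- The product measure for the full 7-variable integrand of `Q_s`-moments:
variables `(ξ, I, ξ_*, I_*, σ, r, R)`. -/
def stdMeasure : Measure (V3 × ℝ × V3 × ℝ × Sph × ℝ × ℝ) :=
  (volume : Measure V3).prod
    (((volume : Measure ℝ).restrict (Set.Ici 0)).prod
      ((volume : Measure V3).prod
        (((volume : Measure ℝ).restrict (Set.Ici 0)).prod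
          (sphMeasure.prod
            (((volume : Measure ℝ).restrict (Set.Icc 0 1)).prod
              ((volume : Measure ℝ).restrict (Set.Icc 0 1)))))))

/-- The product measure for the full 6-variable integrand of `Q_r`-moments:
variables `(ξ, I, ξ_*, I_*, σ, r)`. -/
def resMeasure : Measure (V3 × ℝ × V3 × ℝ × Sph × ℝ) :=
  (volume : Measure V3).prod
    (((volume : Measure ℝ).restrict (Set.Ici 0)).prod
      ((volume : Measure V3).prod
        (((volume : Measure ℝ).restrict (Set.Ici 0)).prod
          (sphMeasure.prod ((volume : Measure ℝ).restrict (Set.Icc 0 1))))))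

/-- The product measure for the kernel variables `(I_*, ξ_*, σ, r)` of `L_r`. -/
def resKernelMeasure : Measure (ℝ × V3 × Sph × ℝ) :=
  ((volume : Measure ℝ).restrict (Set.Ici 0)).prod
    ((volume : Measure V3).prod (sphMeasure.prod ((volume : Measure ℝ).restrict (Set.Icc 0 1))))

/-- The direction `w / |w|`, with an arbitrary value at `w = 0`. -/
def direction (w : V3) : Sph :=
  if hw : w = 0 then ⟨EuclideanSpace.single 0 1, by simp⟩
  else ⟨‖w‖⁻¹ • w, by simp [norm_smul, hw]⟩

lemma norm_smul_direction (w : V3) : ‖w‖ • (direction w : V3) = w := by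
  unfold direction
  split_ifs with hw
  · simp [hw]
  · simp [smul_smul, hw]

lemma direction_smul {ρ : ℝ} (hρ : 0 < ρ) (ω : Sph) : direction (ρ • (ω : V3)) = ω := by
  have hω : ‖(ω : V3)‖ = 1 := norm_eq_of_mem_sphere ω
  have hnorm : ‖ρ • (ω : V3)‖ = ρ := by rw [norm_smul, hω, Real.norm_of_nonneg hρ.le, mul_one]
  ext1
  have key := norm_smul_direction (ρ • (ω : V3))
  rw [hnorm] at key
  exact smul_right_injective V3 hρ.ne' key

lemma measurable_direction : Measurable direction := by
  have hval : ∀ w, (direction w : V3) = if w = 0 then EuclideanSpace.single 0 1 else ‖w‖⁻¹ • w := by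
    intro w
    unfold direction
    split_ifs <;> rfl
  have hmeas : Measurable fun w => (direction w : V3) := by
    simp only [hval]
    exact Measurable.ite (measurableSet_singleton 0) measurable_const (by fun_prop)
  exact hmeas.subtype_mk (h := fun w => (direction w).2)

instance : IsFiniteMeasure sphMeasure := by unfold sphMeasure; infer_instance

/-- The radial measure `ρ² dρ` on `(0,∞)`. -/
abbrev radialMeasure : Measure (Set.Ioi (0 : ℝ)) := Measure.volumeIoiPow 2

lemma lintegral_polar {f : V3 → ENNReal} (hf : Measurable f) :
    ∫⁻ w, f w = ∫⁻ ρ, ∫⁻ ω, f ((ρ : ℝ) • (ω : V3)) ∂sphMeasure ∂radialMeasure := by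
  have hp := (volume : Measure V3).measurePreserving_homeomorphUnitSphereProd
  have hdim : Module.finrank ℝ V3 - 1 = 2 := by simp
  rw [hdim] at hp
  have hmeas : Measurable fun p : Sph × Set.Ioi (0 : ℝ) => f ((p.2 : ℝ) • (p.1 : V3)) := by
    fun_prop
  calc
    ∫⁻ w, f w = ∫⁻ w : ({0}ᶜ : Set V3), f w ∂((volume : Measure V3).comap Subtype.val) := by
      rw [lintegral_subtype_comap (measurableSet_singleton _).compl, restrict_compl_singleton]
    _ = ∫⁻ w : ({0}ᶜ : Set V3), (fun p : Sph × Set.Ioi (0 : ℝ) => f ((p.2 : ℝ) • (p.1 : V3)))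
          (homeomorphUnitSphereProd V3 w) ∂((volume : Measure V3).comap Subtype.val) := by
      refine lintegral_congr fun w => ?_
      have hw : ‖(w : V3)‖ ≠ 0 := norm_ne_zero_iff.2 w.2
      simp [smul_smul, hw]
    _ = ∫⁻ p, f ((p.2 : ℝ) • (p.1 : V3)) ∂(sphMeasure.prod radialMeasure) :=
      hp.lintegral_comp hmeas
    _ = _ := lintegral_prod_symm' _ hmeas

lemma lintegral_center_of_mass {f : V3 × V3 → ENNReal} (hf : Measurable f) :
    ∫⁻ ξ, ∫⁻ ξs, f (ξ, ξs) =
      ∫⁻ V : V3, ∫⁻ w : V3, f (V + (1 / 2 : ℝ) • w, V - (1 / 2 : ℝ) • w) := by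
  calc
    ∫⁻ ξ, ∫⁻ ξs, f (ξ, ξs) = ∫⁻ ξ : V3, ∫⁻ w : V3, f (ξ, ξ - w) :=
      lintegral_congr fun ξ => (lintegral_sub_left_eq_self (fun ξs => f (ξ, ξs)) ξ).symm
    _ = ∫⁻ w : V3, ∫⁻ ξ : V3, f (ξ, ξ - w) := lintegral_lintegral_swap (by fun_prop)
    _ = ∫⁻ w : V3, ∫⁻ V : V3, f (V + (1 / 2 : ℝ) • w, V - (1 / 2 : ℝ) • w) := by
      refine lintegral_congr fun w => ?_
      rw [← lintegral_add_right_eq_self _ ((1 / 2 : ℝ) • w)]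
      refine lintegral_congr fun V => ?_
      congr 2
      module
    _ = _ := lintegral_lintegral_swap (by fun_prop)

/-- The measure on the velocity variables `(ξ, ξ_*, σ)`. -/
def velMeasure : Measure (V3 × V3 × Sph) :=
  (volume : Measure V3).prod ((volume : Measure V3).prod sphMeasure)

instance : SigmaFinite velMeasure := by
  have : SigmaFinite ((volume : Measure V3).prod sphMeasure) := inferInstance
  exact Measure.prod.instSigmaFinite

/-- The velocity part of the resonant collision map; the new angle is the old relative direction. -/
def collVel (p : V3 × V3 × Sph) : V3 × V3 × Sph :=
  (xiPrimeRes p.1 p.2.1 p.2.2, xiStarPrimeRes p.1 p.2.1 p.2.2, direction (p.1 - p.2.1))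

lemma measurable_collVel : Measurable collVel := by
  unfold collVel xiPrimeRes xiStarPrimeRes
  have := measurable_direction
  fun_prop

lemma lintegral_center_of_mass_polar {f : V3 × V3 × Sph → ENNReal} (hf : Measurable f) :
    ∫⁻ p, f p ∂velMeasure =
      ∫⁻ V : V3, ∫⁻ ρ, ∫⁻ ω : Sph, ∫⁻ σ : Sph,
        f (V + (ρ / 2 : ℝ) • (ω : V3), V - (ρ / 2 : ℝ) • (ω : V3), σ)
          ∂sphMeasure ∂sphMeasure ∂radialMeasure := by
  calc
    _ = ∫⁻ ξ : V3, ∫⁻ ξs : V3, ∫⁻ σ, f (ξ, ξs, σ) ∂sphMeasure := by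
      rw [velMeasure, lintegral_prod _ hf.aemeasurable]
      refine lintegral_congr fun ξ => ?_
      rw [lintegral_prod _ (by fun_prop)]
    _ = ∫⁻ V : V3, ∫⁻ w : V3,
          ∫⁻ σ, f (V + (1 / 2 : ℝ) • w, V - (1 / 2 : ℝ) • w, σ) ∂sphMeasure :=
      lintegral_center_of_mass (f := fun q : V3 × V3 => ∫⁻ σ, f (q.1, q.2, σ) ∂sphMeasure)
        (Measurable.lintegral_prod_right (by fun_prop))
    _ = _ := by
      refine lintegral_congr fun V => ?_
      rw [lintegral_polar (Measurable.lintegral_prod_right (by fun_prop))]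
      simp only [smul_smul, one_div_mul_eq_div]

lemma measurePreserving_collVel :
    MeasurePreserving collVel velMeasure velMeasure := by
  refine ⟨measurable_collVel, Measure.ext_of_lintegral _ fun f hf => ?_⟩
  rw [lintegral_map hf measurable_collVel,
    lintegral_center_of_mass_polar (f := fun p => f (collVel p)) (hf.comp measurable_collVel),
    lintegral_center_of_mass_polar hf]
  refine lintegral_congr fun V => lintegral_congr fun ρ => ?_
  have hcoll : ∀ ω σ : Sph,
      collVel (V + ((ρ : ℝ) / 2) • (ω : V3), V - ((ρ : ℝ) / 2) • (ω : V3), σ) =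
        (V + ((ρ : ℝ) / 2) • (σ : V3), V - ((ρ : ℝ) / 2) • (σ : V3), ω) := by
    intro ω σ
    have hρ : (0 : ℝ) < ρ := ρ.2
    have hsub : V + ((ρ : ℝ) / 2) • (ω : V3) - (V - ((ρ : ℝ) / 2) • (ω : V3)) =
        (ρ : ℝ) • (ω : V3) := by module
    have hadd : (1 / 2 : ℝ) • (V + ((ρ : ℝ) / 2) • (ω : V3) + (V - ((ρ : ℝ) / 2) • (ω : V3))) =
        V := by module
    have hω : ‖(ω : V3)‖ = 1 := norm_eq_of_mem_sphere ω
    simp only [collVel, xiPrimeRes, xiStarPrimeRes, hsub, hadd, direction_smul hρ, norm_smul, hω,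
      Real.norm_of_nonneg hρ.le, mul_one]
  simp only [hcoll]
  exact lintegral_lintegral_swap (by fun_prop)

lemma lintegral_eq_mul_lintegral_scale {E : ℝ} (hE : E ≠ 0) {f : ℝ → ENNReal} (hf : Measurable f) :
    ∫⁻ x, f x = ENNReal.ofReal |E| * ∫⁻ s, f (s * E) := by
  conv_lhs => rw [← Real.smul_map_volume_mul_right hE]
  rw [lintegral_smul_measure, lintegral_map hf (by fun_prop), smul_eq_mul]

lemma lintegral_quadrant {f : ℝ × ℝ → ENNReal} (hf : Measurable f) :
    ∫⁻ I in Set.Ici (0 : ℝ), ∫⁻ Is in Set.Ici (0 : ℝ), f (I, Is) =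
      ∫⁻ E in Set.Ioi (0 : ℝ), ENNReal.ofReal E *
        ∫⁻ s in Set.Icc (0 : ℝ) 1, f (s * E, (1 - s) * E) := by
  set F : ℝ × ℝ → ENNReal := (Set.Ici (0 : ℝ) ×ˢ Set.Ici (0 : ℝ)).indicator f with hF
  have hFm : Measurable F := hf.indicator (measurableSet_Ici.prod measurableSet_Ici)
  have hFi : ∀ I Is : ℝ, F (I, Is) =
      (Set.Ici (0 : ℝ)).indicator (fun I => (Set.Ici (0 : ℝ)).indicator
        (fun Is => f (I, Is)) Is) I := by
    intro I Is
    by_cases h1 : 0 ≤ I <;> by_cases h2 : 0 ≤ Is <;> simp [hF, Set.indicator, h1, h2]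
  calc
    _ = ∫⁻ I : ℝ, ∫⁻ Is : ℝ, F (I, Is) := by
      rw [← lintegral_indicator measurableSet_Ici]
      refine lintegral_congr fun I => ?_
      simp only [hFi]
      by_cases h1 : 0 ≤ I
      · simp [Set.indicator_of_mem (Set.mem_Ici.2 h1), lintegral_indicator measurableSet_Ici]
      · simp [Set.indicator, h1]
    _ = ∫⁻ I : ℝ, ∫⁻ E : ℝ, F (I, E - I) :=
      lintegral_congr fun I => (lintegral_sub_right_eq_self (fun Is => F (I, Is)) I).symm
    _ = ∫⁻ E : ℝ, ∫⁻ I : ℝ, F (I, E - I) := lintegral_lintegral_swap (by fun_prop)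
    _ = _ := by
      rw [← lintegral_indicator measurableSet_Ioi]
      refine lintegral_congr_ae ?_
      filter_upwards [Measure.ae_ne volume (0 : ℝ)] with E hE
      rw [lintegral_eq_mul_lintegral_scale hE (by fun_prop)]
      rcases lt_or_gt_of_ne hE with hneg | hpos
      · rw [Set.indicator_of_notMem (by simpa using hneg.le)]
        have hzero : ∀ s : ℝ, F (s * E, E - s * E) = 0 := by
          intro s
          refine Set.indicator_of_notMem ?_ _
          rintro ⟨h1, h2⟩
          simp only [Set.mem_Ici] at h1 h2
          linarith
        simp [hzero]
      · rw [Set.indicator_of_mem (Set.mem_Ioi.2 hpos), abs_of_pos hpos,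
          ← lintegral_indicator measurableSet_Icc]
        congr 1
        refine lintegral_congr fun s => ?_
        have hs : E - s * E = (1 - s) * E := by ring
        rw [hs]
        simp only [hF, Set.indicator, Set.mem_prod, Set.mem_Ici, Set.mem_Icc,
          mul_nonneg_iff_of_pos_right hpos, sub_nonneg]

/-- The measure on the internal energy variables `(I, I_*, r)`. -/
def intMeasure : Measure (ℝ × ℝ × ℝ) :=
  ((volume : Measure ℝ).restrict (Set.Ici 0)).prod
    (((volume : Measure ℝ).restrict (Set.Ici 0)).prod
      ((volume : Measure ℝ).restrict (Set.Icc 0 1)))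

/-- The internal energy part of the resonant collision map; the new exchange parameter is the
old energy ratio. -/
def collInt (q : ℝ × ℝ × ℝ) : ℝ × ℝ × ℝ :=
  (IPrimeRes q.1 q.2.1 q.2.2, IStarPrimeRes q.1 q.2.1 q.2.2, q.1 / (q.1 + q.2.1))

lemma measurable_collInt : Measurable collInt := by
  unfold collInt IPrimeRes IStarPrimeRes
  fun_prop

lemma lintegral_intMeasure {f : ℝ × ℝ × ℝ → ENNReal} (hf : Measurable f) :
    ∫⁻ q, f q ∂intMeasure =
      ∫⁻ E in Set.Ioi (0 : ℝ), ENNReal.ofReal E *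
        ∫⁻ s in Set.Icc (0 : ℝ) 1, ∫⁻ r in Set.Icc (0 : ℝ) 1, f (s * E, (1 - s) * E, r) := by
  calc
    _ = ∫⁻ I in Set.Ici (0 : ℝ), ∫⁻ Is in Set.Ici (0 : ℝ),
          ∫⁻ r in Set.Icc (0 : ℝ) 1, f (I, Is, r) := by
      rw [intMeasure, lintegral_prod _ hf.aemeasurable]
      refine lintegral_congr fun I => ?_
      rw [lintegral_prod _ (by fun_prop)]
    _ = _ :=
      lintegral_quadrant (f := fun q : ℝ × ℝ => ∫⁻ r in Set.Icc (0 : ℝ) 1, f (q.1, q.2, r))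
        (Measurable.lintegral_prod_right (by fun_prop))

lemma measurePreserving_collInt : MeasurePreserving collInt intMeasure intMeasure := by
  refine ⟨measurable_collInt, Measure.ext_of_lintegral _ fun f hf => ?_⟩
  rw [lintegral_map hf measurable_collInt,
    lintegral_intMeasure (f := fun q => f (collInt q)) (hf.comp measurable_collInt),
    lintegral_intMeasure hf]
  refine setLIntegral_congr_fun measurableSet_Ioi fun E hE => ?_
  have hE0 : E ≠ 0 := (Set.mem_Ioi.1 hE).ne'
  have hcoll : ∀ s r : ℝ, collInt (s * E, (1 - s) * E, r) = (r * E, (1 - r) * E, s) := by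
    intro s r
    have hsum : s * E + (1 - s) * E = E := by ring
    simp only [collInt, IPrimeRes, IStarPrimeRes, hsum, mul_div_cancel_right₀ s hE0]
  simp only [hcoll]
  congr 1
  exact lintegral_lintegral_swap (by fun_prop)

section Regrouping

variable {A B C D S R : Type*} [MeasurableSpace A] [MeasurableSpace B] [MeasurableSpace C]
  [MeasurableSpace D] [MeasurableSpace S] [MeasurableSpace R]

lemma measurePreserving_prodLeftComm (μ : Measure A) (ν : Measure B) (τ : Measure C)
    [SigmaFinite μ] [SigmaFinite ν] [SigmaFinite τ] :
    MeasurePreserving (fun p : A × B × C => (p.2.1, p.1, p.2.2))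
      (μ.prod (ν.prod τ)) (ν.prod (μ.prod τ)) :=
  (measurePreserving_prodAssoc ν μ τ).comp
    ((Measure.measurePreserving_swap.prod (MeasurePreserving.id τ)).comp
      (measurePreserving_prodAssoc μ ν τ).symm)

lemma measurePreserving_regroup (a : Measure A) (b : Measure B) (c : Measure C) (d : Measure D)
    (s : Measure S) (r : Measure R) [SigmaFinite a] [SigmaFinite b] [SigmaFinite c]
    [SigmaFinite d] [SigmaFinite s] [SigmaFinite r] :
    MeasurePreserving
      (fun p : (A × B) × C × D × S × R =>
        ((p.1.1, p.2.2.1, p.2.2.2.1), (p.1.2, p.2.1, p.2.2.2.2)))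
      ((a.prod b).prod (c.prod (d.prod (s.prod r))))
      ((a.prod (d.prod s)).prod (b.prod (c.prod r))) := by
  have hinner : MeasurePreserving
      (fun p : C × D × S × R => ((p.2.1, p.2.2.1), (p.1, p.2.2.2)))
      (c.prod (d.prod (s.prod r))) ((d.prod s).prod (c.prod r)) :=
    (measurePreserving_prodAssoc d s (c.prod r)).symm.comp
      (((MeasurePreserving.id d).prod (measurePreserving_prodLeftComm c s r)).comp
        (measurePreserving_prodLeftComm c d (s.prod r)))
  exact (measurePreserving_prodAssoc a (d.prod s) (b.prod (c.prod r))).symm.comp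
    (((MeasurePreserving.id a).prod (measurePreserving_prodLeftComm b (d.prod s) (c.prod r))).comp
      ((measurePreserving_prodAssoc a b ((d.prod s).prod (c.prod r))).comp
        ((MeasurePreserving.id (a.prod b)).prod hinner)))

lemma integral_prod_four {c : Measure C} {d : Measure D} {s : Measure S} {r : Measure R}
    [SFinite c] [SFinite d] [SFinite s] [SFinite r] {f : C × D × S × R → ℝ}
    (hf : Integrable f (c.prod (d.prod (s.prod r)))) :
    ∫ p, f p ∂(c.prod (d.prod (s.prod r))) =
      ∫ x, ∫ y, ∫ z, ∫ w, f (x, y, z, w) ∂r ∂s ∂d ∂c := by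
  rw [integral_prod _ hf]
  refine integral_congr_ae ?_
  filter_upwards [hf.prod_right_ae] with x hx
  rw [integral_prod _ hx]
  refine integral_congr_ae ?_
  filter_upwards [hx.prod_right_ae] with y hy
  exact integral_prod _ hy

end Regrouping

/-- If `K` is invariant under the measure-preserving map `S` and changes sign under the
measure-preserving map `C`, then integrating `K` against `G` amounts to integrating it against the
(anti)symmetrization of `G`. -/
lemma integral_mul_symmetrization {Y : Type*} [MeasurableSpace Y] {μ : Measure Y} {S C : Y → Y}
    (hS : MeasurePreserving S μ μ) (hC : MeasurePreserving C μ μ) {K G : Y → ℝ}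
    (hK : Measurable K) (hG : Measurable G) (hKS : ∀ᵐ y ∂μ, K (S y) = K y)
    (hKC : ∀ᵐ y ∂μ, K (C y) = -K y) (hint : Integrable (fun y => K y * G y) μ) :
    ∫ y, K y * (G (S (C y)) + G (C y) - G (S y) - G y) ∂μ = -4 * ∫ y, K y * G y ∂μ := by
  have pull : ∀ {T : Y → Y} {F : Y → ℝ}, MeasurePreserving T μ μ → Measurable F →
      Integrable (fun y => K y * F y) μ →
      Integrable (fun y => K (T y) * F (T y)) μ ∧
        ∫ y, K (T y) * F (T y) ∂μ = ∫ y, K y * F y ∂μ := by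
    intro T F hT hF hi
    refine ⟨(hT.integrable_comp hi.aestronglyMeasurable).2 hi, ?_⟩
    conv_rhs => rw [← hT.map_eq]
    exact (integral_map hT.measurable.aemeasurable
      (hK.mul hF).aestronglyMeasurable).symm
  have swap : ∀ {F : Y → ℝ}, Measurable F → Integrable (fun y => K y * F y) μ →
      Integrable (fun y => K y * F (S y)) μ ∧
        ∫ y, K y * F (S y) ∂μ = ∫ y, K y * F y ∂μ := by
    intro F hF hi
    have hcongr : (fun y => K (S y) * F (S y)) =ᵐ[μ] fun y => K y * F (S y) := by
      filter_upwards [hKS] with y hy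
      rw [hy]
    obtain ⟨h1, h2⟩ := pull hS hF hi
    exact ⟨h1.congr hcongr, by rw [← integral_congr_ae hcongr, h2]⟩
  have coll : ∀ {F : Y → ℝ}, Measurable F → Integrable (fun y => K y * F y) μ →
      Integrable (fun y => K y * F (C y)) μ ∧
        ∫ y, K y * F (C y) ∂μ = -∫ y, K y * F y ∂μ := by
    intro F hF hi
    have hcongr : (fun y => -(K (C y) * F (C y))) =ᵐ[μ] fun y => K y * F (C y) := by
      filter_upwards [hKC] with y hy
      rw [hy]
      ring
    obtain ⟨h1, h2⟩ := pull hC hF hi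
    exact ⟨h1.neg.congr hcongr, by rw [← integral_congr_ae hcongr, integral_neg, h2]⟩
  obtain ⟨i1, e1⟩ := swap hG hint
  obtain ⟨i2, e2⟩ := coll hG hint
  obtain ⟨i3, e3⟩ := coll (F := fun y => G (S y)) (hG.comp hS.measurable) i1
  simp only [mul_add, mul_sub]
  have i32 : Integrable (fun y => K y * G (S (C y)) + K y * G (C y)) μ := i3.add i2
  have i321 : Integrable (fun y => K y * G (S (C y)) + K y * G (C y) - K y * G (S y)) μ :=
    i32.sub i1
  rw [integral_sub i321 hint, integral_sub i32 i1, integral_add i3 i2, e3, e2, e1]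
  ring

lemma xiPrimeRes_add_xiStarPrimeRes (ξ ξs : V3) (σ : Sph) :
    xiPrimeRes ξ ξs σ + xiStarPrimeRes ξ ξs σ = ξ + ξs := by
  unfold xiPrimeRes xiStarPrimeRes
  module

lemma xiPrimeRes_sub_xiStarPrimeRes (ξ ξs : V3) (σ : Sph) :
    xiPrimeRes ξ ξs σ - xiStarPrimeRes ξ ξs σ = ‖ξ - ξs‖ • (σ : V3) := by
  unfold xiPrimeRes xiStarPrimeRes
  module

lemma norm_xiPrimeRes_sub_xiStarPrimeRes (ξ ξs : V3) (σ : Sph) :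
    ‖xiPrimeRes ξ ξs σ - xiStarPrimeRes ξ ξs σ‖ = ‖ξ - ξs‖ := by
  rw [xiPrimeRes_sub_xiStarPrimeRes, norm_smul, norm_norm, norm_eq_of_mem_sphere σ, mul_one]

lemma xiPrimeRes_swap (ξ ξs : V3) (σ : Sph) : xiPrimeRes ξs ξ σ = xiPrimeRes ξ ξs σ := by
  rw [xiPrimeRes, xiPrimeRes, add_comm ξs, norm_sub_rev]

lemma xiStarPrimeRes_swap (ξ ξs : V3) (σ : Sph) :
    xiStarPrimeRes ξs ξ σ = xiStarPrimeRes ξ ξs σ := by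
  rw [xiStarPrimeRes, xiStarPrimeRes, add_comm ξs, norm_sub_rev]

lemma xiPrimeRes_collision (ξ ξs : V3) (σ : Sph) :
    xiPrimeRes (xiPrimeRes ξ ξs σ) (xiStarPrimeRes ξ ξs σ) (direction (ξ - ξs)) = ξ := by
  rw [xiPrimeRes, xiPrimeRes_add_xiStarPrimeRes, norm_xiPrimeRes_sub_xiStarPrimeRes,
    div_eq_inv_mul ‖ξ - ξs‖, mul_smul, norm_smul_direction]
  module

lemma xiStarPrimeRes_collision (ξ ξs : V3) (σ : Sph) :
    xiStarPrimeRes (xiPrimeRes ξ ξs σ) (xiStarPrimeRes ξ ξs σ) (direction (ξ - ξs)) = ξs := by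
  rw [xiStarPrimeRes, xiPrimeRes_add_xiStarPrimeRes, norm_xiPrimeRes_sub_xiStarPrimeRes,
    div_eq_inv_mul ‖ξ - ξs‖, mul_smul, norm_smul_direction]
  module

lemma norm_sq_add_norm_sq (ξ ξs u : V3) :
    ‖ξ - u‖ ^ 2 + ‖ξs - u‖ ^ 2 = (‖ξ + ξs - (2 : ℝ) • u‖ ^ 2 + ‖ξ - ξs‖ ^ 2) / 2 := by
  have hpar := parallelogram_law_with_norm ℝ (ξ - u) (ξs - u)
  have hadd : ξ - u + (ξs - u) = ξ + ξs - (2 : ℝ) • u := by module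
  rw [hadd, sub_sub_sub_cancel_right] at hpar
  linarith

lemma kinetic_energy_collision (ξ ξs u : V3) (σ : Sph) :
    ‖xiPrimeRes ξ ξs σ - u‖ ^ 2 + ‖xiStarPrimeRes ξ ξs σ - u‖ ^ 2 =
      ‖ξ - u‖ ^ 2 + ‖ξs - u‖ ^ 2 := by
  rw [norm_sq_add_norm_sq, norm_sq_add_norm_sq ξ, xiPrimeRes_add_xiStarPrimeRes,
    norm_xiPrimeRes_sub_xiStarPrimeRes]

lemma IPrimeRes_add_IStarPrimeRes (I Is r : ℝ) :
    IPrimeRes I Is r + IStarPrimeRes I Is r = I + Is := by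
  unfold IPrimeRes IStarPrimeRes
  ring

lemma IPrimeRes_collision {I Is : ℝ} (hE : I + Is ≠ 0) (r : ℝ) :
    IPrimeRes (IPrimeRes I Is r) (IStarPrimeRes I Is r) (I / (I + Is)) = I := by
  rw [IPrimeRes, IPrimeRes_add_IStarPrimeRes, div_mul_cancel₀ I hE]

lemma IStarPrimeRes_collision {I Is : ℝ} (hE : I + Is ≠ 0) (r : ℝ) :
    IStarPrimeRes (IPrimeRes I Is r) (IStarPrimeRes I Is r) (I / (I + Is)) = Is := by
  rw [IStarPrimeRes, IPrimeRes_add_IStarPrimeRes]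
  field_simp
  ring

/-- Pre-collisional variables `((ξ, ξ_*, σ), (I, I_*, r))`. -/
abbrev CollState : Type := (V3 × V3 × Sph) × ℝ × ℝ × ℝ

/-- The product measure on the pre-collisional variables. -/
def collMeasure : Measure CollState := velMeasure.prod intMeasure

/-- The resonant collision map. -/
def collMap : CollState → CollState := Prod.map collVel collInt

/-- The exchange of the two colliding particles. -/
def exchange (y : CollState) : CollState :=
  ((y.1.2.1, y.1.1, y.1.2.2), (y.2.2.1, y.2.1, y.2.2.2))

instance : SigmaFinite intMeasure := by unfold intMeasure; infer_instance

lemma measurePreserving_collMap : MeasurePreserving collMap collMeasure collMeasure :=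
  measurePreserving_collVel.prod measurePreserving_collInt

lemma measurePreserving_exchange : MeasurePreserving exchange collMeasure collMeasure := by
  have hvel : MeasurePreserving (fun p : V3 × V3 × Sph => (p.2.1, p.1, p.2.2))
      velMeasure velMeasure := measurePreserving_prodLeftComm _ _ _
  have hint : MeasurePreserving (fun q : ℝ × ℝ × ℝ => (q.2.1, q.1, q.2.2))
      intMeasure intMeasure := measurePreserving_prodLeftComm _ _ _
  exact hvel.prod hint

lemma ae_pos_collMeasure :
    ∀ᵐ y ∂collMeasure, 0 < y.2.1 ∧ 0 < y.2.2.1 ∧ y.2.2.2 ∈ Set.Icc (0 : ℝ) 1 := by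
  have hpos : ∀ᵐ I ∂((volume : Measure ℝ).restrict (Set.Ici 0)), 0 < I := by
    filter_upwards [ae_restrict_mem measurableSet_Ici,
      ae_restrict_of_ae (Measure.ae_ne volume (0 : ℝ))] with I hI hI0
    exact lt_of_le_of_ne hI hI0.symm
  have hint : ∀ᵐ q ∂intMeasure, 0 < q.1 ∧ 0 < q.2.1 ∧ q.2.2 ∈ Set.Icc (0 : ℝ) 1 := by
    filter_upwards [Measure.quasiMeasurePreserving_fst.ae hpos,
      (Measure.quasiMeasurePreserving_fst.comp Measure.quasiMeasurePreserving_snd).ae hpos,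
      (Measure.quasiMeasurePreserving_snd.comp Measure.quasiMeasurePreserving_snd).ae
        (ae_restrict_mem measurableSet_Icc)] with q h1 h2 h3
    exact ⟨h1, h2, h3⟩
  exact Measure.quasiMeasurePreserving_snd.ae hint

/-- The total increment of `h` across a collision. -/
def collDiff (h : V3 → ℝ → ℝ) (y : CollState) : ℝ :=
  h (exchange (collMap y)).1.1 (exchange (collMap y)).2.1 + h (collMap y).1.1 (collMap y).2.1 -
    h (exchange y).1.1 (exchange y).2.1 - h y.1.1 y.2.1

lemma measurable_eval_first {h : V3 → ℝ → ℝ} (hh : Measurable (Function.uncurry h)) :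
    Measurable fun y : CollState => h y.1.1 y.2.1 :=
  hh.comp (g := Function.uncurry h) (f := fun y : CollState => (y.1.1, y.2.1)) (by fun_prop)

lemma measurable_collDiff {h : V3 → ℝ → ℝ} (hh : Measurable (Function.uncurry h)) :
    Measurable (collDiff h) := by
  have h0 := measurable_eval_first hh
  have hc := measurePreserving_collMap.measurable
  have hs := measurePreserving_exchange.measurable
  exact (((h0.comp (hs.comp hc)).add (h0.comp hc)).sub (h0.comp hs)).sub h0

lemma collDiff_exchange (h : V3 → ℝ → ℝ) (y : CollState) :
    collDiff h (exchange y) = collDiff h y := by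
  obtain ⟨⟨ξ, ξs, σ⟩, I, Is, r⟩ := y
  simp only [collDiff, exchange, collMap, collVel, collInt, Prod.map, xiPrimeRes_swap ξ ξs,
    xiStarPrimeRes_swap ξ ξs, IPrimeRes, IStarPrimeRes, add_comm Is I]
  ring

lemma collDiff_collMap (h : V3 → ℝ → ℝ) {y : CollState} (hE : y.2.1 + y.2.2.1 ≠ 0) :
    collDiff h (collMap y) = -collDiff h y := by
  obtain ⟨⟨ξ, ξs, σ⟩, I, Is, r⟩ := y
  simp only [collDiff, exchange, collMap, collVel, collInt, Prod.map, xiPrimeRes_collision,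
    xiStarPrimeRes_collision, IPrimeRes_collision hE, IStarPrimeRes_collision hE]
  ring

section Weight

variable (m kB δ n Ttr Tint α β : ℝ) (u : V3)

/-- The weight of a collision in the weighted inner product. -/
def collWeight (y : CollState) : ℝ :=
  Mr m kB δ n Ttr Tint u y.1.1 y.2.1 * Mr m kB δ n Ttr Tint u y.1.2.1 y.2.2.1 *
    (y.2.1 + y.2.2.1) ^ α * ‖y.1.1 - y.1.2.1‖ ^ β * (y.2.2.2 * (1 - y.2.2.2)) ^ (δ / 2 - 1)

lemma measurable_collWeight : Measurable (collWeight m kB δ n Ttr Tint α β u) := by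
  unfold collWeight Mr
  fun_prop

lemma collWeight_exchange (y : CollState) :
    collWeight m kB δ n Ttr Tint α β u (exchange y) = collWeight m kB δ n Ttr Tint α β u y := by
  simp only [collWeight, exchange]
  rw [add_comm y.2.2.1, norm_sub_rev, mul_comm (Mr m kB δ n Ttr Tint u y.1.2.1 y.2.2.1)]

lemma Mr_mul_Mr (ξ ξs : V3) (I Is : ℝ) :
    Mr m kB δ n Ttr Tint u ξ I * Mr m kB δ n Ttr Tint u ξs Is =
      (n / ((2 * π * kB * Ttr / m) ^ ((3 : ℝ) / 2) * (kB * Tint) ^ (δ / 2) *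
        Real.Gamma (δ / 2))) ^ 2 * (I ^ (δ / 2 - 1) * Is ^ (δ / 2 - 1)) *
      Real.exp (-(m * (‖ξ - u‖ ^ 2 + ‖ξs - u‖ ^ 2)) / (2 * kB * Ttr) - (I + Is) / (kB * Tint)) := by
  have hexp : -(m * (‖ξ - u‖ ^ 2 + ‖ξs - u‖ ^ 2)) / (2 * kB * Ttr) - (I + Is) / (kB * Tint) =
      (-(m * ‖ξ - u‖ ^ 2) / (2 * kB * Ttr) - I / (kB * Tint)) +
        (-(m * ‖ξs - u‖ ^ 2) / (2 * kB * Ttr) - Is / (kB * Tint)) := by ring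
  rw [hexp, Real.exp_add, Mr, Mr]
  ring

lemma rpow_collision {I Is r : ℝ} (hI : 0 < I) (hIs : 0 < Is) (hr : r ∈ Set.Icc (0 : ℝ) 1)
    (p : ℝ) :
    IPrimeRes I Is r ^ p * IStarPrimeRes I Is r ^ p *
        (I / (I + Is) * (1 - I / (I + Is))) ^ p =
      I ^ p * Is ^ p * (r * (1 - r)) ^ p := by
  have hr1 : 0 ≤ 1 - r := sub_nonneg.2 hr.2
  have hr0 : 0 ≤ r := hr.1
  have hE : 0 < I + Is := add_pos hI hIs
  have hratio : 1 - I / (I + Is) = Is / (I + Is) := by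
    field_simp
    ring
  rw [hratio, IPrimeRes, IStarPrimeRes, ← Real.mul_rpow (by positivity) (by positivity),
    ← Real.mul_rpow (by positivity) (by positivity),
    ← Real.mul_rpow (by positivity) (by positivity),
    ← Real.mul_rpow (by positivity) (by positivity)]
  congr 1
  field_simp

lemma collWeight_collMap {y : CollState} (hI : 0 < y.2.1) (hIs : 0 < y.2.2.1)
    (hr : y.2.2.2 ∈ Set.Icc (0 : ℝ) 1) :
    collWeight m kB δ n Ttr Tint α β u (collMap y) = collWeight m kB δ n Ttr Tint α β u y := by
  obtain ⟨⟨ξ, ξs, σ⟩, I, Is, r⟩ := y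
  simp only [collWeight, collMap, collVel, collInt, Prod.map, Mr_mul_Mr, kinetic_energy_collision,
    IPrimeRes_add_IStarPrimeRes, norm_xiPrimeRes_sub_xiStarPrimeRes]
  linear_combination (n / ((2 * π * kB * Ttr / m) ^ ((3 : ℝ) / 2) *
        (kB * Tint) ^ (δ / 2) * Real.Gamma (δ / 2))) ^ 2 *
      Real.exp (-(m * (‖ξ - u‖ ^ 2 + ‖ξs - u‖ ^ 2)) / (2 * kB * Ttr) - (I + Is) / (kB * Tint)) *
      (I + Is) ^ α * ‖ξ - ξs‖ ^ β * rpow_collision hI hIs hr (δ / 2 - 1)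

lemma collWeight_nonneg {y : CollState} (hI : 0 < y.2.1) (hIs : 0 < y.2.2.1)
    (hr : y.2.2.2 ∈ Set.Icc (0 : ℝ) 1) : 0 ≤ collWeight m kB δ n Ttr Tint α β u y := by
  have hr1 : 0 ≤ 1 - y.2.2.2 := sub_nonneg.2 hr.2
  have hr0 : 0 ≤ y.2.2.2 := hr.1
  rw [collWeight, Mr_mul_Mr]
  positivity

lemma measurePreserving_toCollState :
    MeasurePreserving (fun p : (V3 × ℝ) × ℝ × V3 × Sph × ℝ =>
        (((p.1.1, p.2.2.1, p.2.2.2.1), (p.1.2, p.2.1, p.2.2.2.2)) : CollState))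
      (phaseMeasure.prod resKernelMeasure) collMeasure :=
  measurePreserving_regroup _ _ _ _ _ _

variable {m kB δ n Ttr Tint α β u}

lemma LrIntegrand_mul_eq (h g : V3 → ℝ → ℝ) (p : (V3 × ℝ) × ℝ × V3 × Sph × ℝ) :
    LrIntegrand m kB δ n Ttr Tint α β u h p.1.1 p.1.2 p.2.1 p.2.2.1 p.2.2.2.1 p.2.2.2.2 *
        g p.1.1 p.1.2 * Mr m kB δ n Ttr Tint u p.1.1 p.1.2 =
      (fun y : CollState =>
        collWeight m kB δ n Ttr Tint α β u y * collDiff h y * g y.1.1 y.2.1)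
        ((p.1.1, p.2.2.1, p.2.2.2.1), (p.1.2, p.2.1, p.2.2.2.2)) := by
  simp only [LrIntegrand, collWeight, collDiff, exchange, collMap, collVel, collInt, Prod.map]
  ring

instance : SFinite phaseMeasure := by unfold phaseMeasure; infer_instance

instance : SFinite resKernelMeasure := by
  have : SigmaFinite (sphMeasure.prod ((volume : Measure ℝ).restrict (Set.Icc 0 1))) :=
    inferInstance
  have : SigmaFinite ((volume : Measure V3).prod
      (sphMeasure.prod ((volume : Measure ℝ).restrict (Set.Icc 0 1)))) :=
    Measure.prod.instSigmaFinite
  exact Measure.prod.instSFinite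

lemma integral_Lr_mul (Cr : ℝ) {h g : V3 → ℝ → ℝ}
    (hint : Integrable (fun p : (V3 × ℝ) × ℝ × V3 × Sph × ℝ =>
      LrIntegrand m kB δ n Ttr Tint α β u h p.1.1 p.1.2 p.2.1 p.2.2.1 p.2.2.2.1 p.2.2.2.2 *
        g p.1.1 p.1.2 * Mr m kB δ n Ttr Tint u p.1.1 p.1.2)
      (phaseMeasure.prod resKernelMeasure)) :
    ∫ p, Lr m kB δ n Ttr Tint α β Cr u h p.1 p.2 * g p.1 p.2 *
        Mr m kB δ n Ttr Tint u p.1 p.2 ∂phaseMeasure =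
      -Cr * ∫ p : (V3 × ℝ) × ℝ × V3 × Sph × ℝ,
        LrIntegrand m kB δ n Ttr Tint α β u h p.1.1 p.1.2 p.2.1 p.2.2.1 p.2.2.2.1 p.2.2.2.2 *
          g p.1.1 p.1.2 * Mr m kB δ n Ttr Tint u p.1.1 p.1.2
        ∂(phaseMeasure.prod resKernelMeasure) := by
  rw [integral_prod _ hint, ← integral_const_mul]
  refine integral_congr_ae ?_
  filter_upwards [hint.prod_right_ae] with p hp
  simp only [mul_assoc] at hp ⊢
  rw [integral_mul_const]
  rcases eq_or_ne (g p.1 p.2 * Mr m kB δ n Ttr Tint u p.1 p.2) 0 with h0 | h0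
  · simp [h0]
  · have hslice := (integrable_mul_const_iff (IsUnit.mk0 _ h0) _).1 hp
    rw [resKernelMeasure] at hslice ⊢
    rw [integral_prod_four hslice, Lr, mul_assoc]

lemma integral_Lr_mul_eq_collDiff {Cr : ℝ} {h g : V3 → ℝ → ℝ}
    (hh : Measurable (Function.uncurry h)) (hg : Measurable (Function.uncurry g))
    (hint : Integrable (fun p : (V3 × ℝ) × ℝ × V3 × Sph × ℝ =>
      LrIntegrand m kB δ n Ttr Tint α β u h p.1.1 p.1.2 p.2.1 p.2.2.1 p.2.2.2.1 p.2.2.2.2 *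
        g p.1.1 p.1.2 * Mr m kB δ n Ttr Tint u p.1.1 p.1.2)
      (phaseMeasure.prod resKernelMeasure)) :
    ∫ p, Lr m kB δ n Ttr Tint α β Cr u h p.1 p.2 * g p.1 p.2 *
        Mr m kB δ n Ttr Tint u p.1 p.2 ∂phaseMeasure =
      Cr / 4 * ∫ y, collWeight m kB δ n Ttr Tint α β u y * collDiff h y * collDiff g y
        ∂collMeasure := by
  have hK : Measurable fun y => collWeight m kB δ n Ttr Tint α β u y * collDiff h y :=
    (measurable_collWeight m kB δ n Ttr Tint α β u).mul (measurable_collDiff hh)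
  have hF := (hK.mul (measurable_eval_first hg)).aestronglyMeasurable (μ := collMeasure)
  have he := measurePreserving_toCollState
  rw [integral_Lr_mul Cr hint]
  simp only [LrIntegrand_mul_eq] at hint ⊢
  have hmap := integral_map he.measurable.aemeasurable (he.map_eq.symm ▸ hF)
  rw [he.map_eq] at hmap
  have hsymm := integral_mul_symmetrization measurePreserving_exchange measurePreserving_collMap
    hK (measurable_eval_first hg)
    (.of_forall fun y => by rw [collWeight_exchange, collDiff_exchange])
    (by
      filter_upwards [ae_pos_collMeasure] with y ⟨hI, hIs, hr⟩
      rw [collWeight_collMap _ _ _ _ _ _ _ _ _ hI hIs hr,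
        collDiff_collMap h (add_pos hI hIs).ne', mul_neg])
    ((he.integrable_comp hF).1 hint)
  change ∫ y, _ * collDiff g y ∂collMeasure = _ at hsymm
  rw [hsymm]
  refine (congrArg (-Cr * ·) hmap.symm).trans ?_
  simp only [Pi.mul_apply]
  ring

end Weight

/-- the resonant linearized collision operator is symmetric and
nonnegative with respect to the weighted inner product. -/
theorem Lr_symmetric_nonneg (m kB δ α β Cr : ℝ) (hm : 0 < m) (hkB : 0 < kB) (hδ : 2 ≤ δ)
    (hα : α ∈ Set.Ico (0:ℝ) (δ / 2)) (hβ : β ∈ Set.Icc (0:ℝ) 1) (hCr : 0 < Cr)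
    (n Ttr Tint : ℝ) (hn : 0 < n) (hTtr : 0 < Ttr) (hTint : 0 < Tint) (u : V3)
    (h g : V3 → ℝ → ℝ)
    (hh : Measurable (Function.uncurry h)) (hg : Measurable (Function.uncurry g))
    (hint : ∀ h' g' : V3 → ℝ → ℝ,
      ((h' = h ∧ g' = g) ∨ (h' = g ∧ g' = h) ∨ (h' = h ∧ g' = h)) →
      Integrable (fun p : V3 × ℝ =>
          Lr m kB δ n Ttr Tint α β Cr u h' p.1 p.2 * g' p.1 p.2 *
            Mr m kB δ n Ttr Tint u p.1 p.2) phaseMeasure ∧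
      Integrable (fun p : (V3 × ℝ) × ℝ × V3 × Sph × ℝ =>
          LrIntegrand m kB δ n Ttr Tint α β u h' p.1.1 p.1.2 p.2.1 p.2.2.1 p.2.2.2.1
              p.2.2.2.2 *
            g' p.1.1 p.1.2 * Mr m kB δ n Ttr Tint u p.1.1 p.1.2)
        (phaseMeasure.prod resKernelMeasure)) :
    (∫ p, Lr m kB δ n Ttr Tint α β Cr u h p.1 p.2 * g p.1 p.2 *
        Mr m kB δ n Ttr Tint u p.1 p.2 ∂phaseMeasure) =
      (∫ p, h p.1 p.2 * Lr m kB δ n Ttr Tint α β Cr u g p.1 p.2 *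
        Mr m kB δ n Ttr Tint u p.1 p.2 ∂phaseMeasure) ∧
    0 ≤ (∫ p, Lr m kB δ n Ttr Tint α β Cr u h p.1 p.2 * h p.1 p.2 *
        Mr m kB δ n Ttr Tint u p.1 p.2 ∂phaseMeasure) := by
  have hhg := (hint h g (Or.inl ⟨rfl, rfl⟩)).2
  have hgh := (hint g h (Or.inr (Or.inl ⟨rfl, rfl⟩))).2
  have hhh := (hint h h (Or.inr (Or.inr ⟨rfl, rfl⟩))).2
  constructor
  · simp only [mul_comm (h _ _)]
    rw [integral_Lr_mul_eq_collDiff hh hg hhg, integral_Lr_mul_eq_collDiff hg hh hgh]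
    simp only [mul_right_comm _ (collDiff h _)]
  · rw [integral_Lr_mul_eq_collDiff hh hh hhh]
    refine mul_nonneg (by positivity) (integral_nonneg_of_ae ?_)
    filter_upwards [ae_pos_collMeasure] with y ⟨hI, hIs, hr⟩
    rw [Pi.zero_apply, mul_assoc]
    exact mul_nonneg (collWeight_nonneg m kB δ n Ttr Tint α β u hI hIs hr) (mul_self_nonneg _)
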